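/- Let Δ_m = {x ∈ ℝ_{≥0}^m : Σx_i = 1} be the standard simplex and μ : Δ_m → Δ_m a continuous map such that for every subset J ⊆ {1,…,m}, μ maps the face Δ_J = {x ∈ Δ_m : x_i = 0 for i∉J} into itself. Then μ is surjective. -/

import Mathlib

namespace Scarf

/-- Dominance of a finite set with respect to a family of utility functions. -/
def Dom {V I L : Type*} [LinearOrder L] (u : I → V → L) (S : Finset V) : Prop :=
  ∀ y, ∃ i, ∀ x ∈ S, u i y ≤ u i x

/-- `x` is the `u k`-largest element above `mn i` for all `i ≠ k`. -/
def IsMx {V I L : Type*} [LinearOrder L] (u : I → V → L) (mn : I → V) (k : I) (x : V) : Prop :=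
  (∀ i, i ≠ k → u i (mn i) < u i x) ∧
    ∀ y, (∀ i, i ≠ k → u i (mn i) < u i y) → u k y ≤ u k x

theorem IsMx.unique {V I L : Type*} [LinearOrder L] {u : I → V → L}
    (hu : ∀ i, Function.Injective (u i)) {mn : I → V} {k : I} {x y : V}
    (hx : IsMx u mn k x) (hy : IsMx u mn k y) : x = y :=
  hu k (le_antisymm (hy.2 x hx.1) (hx.2 y hy.1))

theorem exists_isMx {V I L : Type*} [Fintype V] [LinearOrder L] (u : I → V → L)
    (mn : I → V) (k : I) (z : V) (hz : ∀ i, i ≠ k → u i (mn i) < u i z) :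
    ∃ x, IsMx u mn k x := by
  classical
  obtain ⟨x, hx, hmax⟩ := Finset.exists_max_image
    (Finset.univ.filter fun y => ∀ i, i ≠ k → u i (mn i) < u i y) (u k) ⟨z, by simpa using hz⟩
  refine ⟨x, by simpa using hx, fun y hy => hmax y (by simpa using hy)⟩

theorem door_aux {V I L : Type*} [DecidableEq V] [LinearOrder L] {u : I → V → L}
    {mn : I → V} {S : Finset V} (hD : Dom u S)
    (hu : ∀ i, Function.Injective (u i))
    (hmem : ∀ i, mn i ∈ S) (hmin : ∀ i, ∀ x ∈ S, u i (mn i) ≤ u i x)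
    {a b : I} (hab : a ≠ b) (hm : mn a = mn b) {x : V} (hx : IsMx u mn a x) :
    x ∉ S ∧ Dom u (insert x S) := by
  constructor
  · intro hxS
    obtain ⟨i, hi⟩ := hD x
    by_cases hia : i = a
    · subst hia
      have : x = mn i := hu i (le_antisymm (hi _ (hmem i)) (hmin i x hxS))
      have h2 := hx.1 b hab.symm
      rw [this, hm] at h2
      exact lt_irrefl _ h2
    · exact absurd (hi _ (hmem i)) (not_le.2 (hx.1 i hia))
  · intro y
    by_cases h : ∃ i, i ≠ a ∧ u i y ≤ u i (mn i)
    · obtain ⟨i, hia, hi⟩ := h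
      refine ⟨i, fun z hz => ?_⟩
      rcases Finset.mem_insert.1 hz with rfl | hz
      · exact hi.trans (hx.1 i hia).le
      · exact hi.trans (hmin i z hz)
    · push Not at h
      refine ⟨a, fun z hz => ?_⟩
      rcases Finset.mem_insert.1 hz with rfl | hz
      · exact hx.2 y h
      · obtain ⟨i, hi⟩ := hD y
        by_cases hia : i = a
        · subst hia; exact hi z hz
        · exact absurd (hi _ (hmem i)) (not_le.2 (h i hia))

theorem door_iff {V I L : Type*} [Fintype I] [DecidableEq V] [LinearOrder L]
    {u : I → V → L}
    {mn : I → V} {S : Finset V} (hD : Dom u S)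
    (hu : ∀ i, Function.Injective (u i)) (hcard : S.card + 1 = Fintype.card I)
    (hmem : ∀ i, mn i ∈ S) (hmin : ∀ i, ∀ x ∈ S, u i (mn i) ≤ u i x)
    {a b : I} (hab : a ≠ b) (hm : mn a = mn b) (x : V) :
    (x ∉ S ∧ Dom u (insert x S)) ↔ (IsMx u mn a x ∨ IsMx u mn b x) := by
  constructor
  · rintro ⟨hxS, hDx⟩
    choose g hg using hDx
    let g' : {z : V // z ∈ insert x S} → I := fun z => g z.1
    have hinj : Function.Injective g' := by
      intro z z' h
      apply Subtype.ext
      apply hu (g' z)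
      apply le_antisymm
      · exact hg z z' z'.2
      · rw [h]; exact hg z' z z.2
    have hbij : Function.Bijective g' := by
      rw [Fintype.bijective_iff_injective_and_card]
      refine ⟨hinj, ?_⟩
      rw [Fintype.card_coe, Finset.card_insert_of_notMem hxS, hcard]
    have key : ∀ i, i ≠ g x → u i (mn i) < u i x ∧ g (mn i) = i := by
      intro i hi
      obtain ⟨⟨z, hz⟩, rfl⟩ := hbij.2 i
      have hzx : z ≠ x := by rintro rfl; exact hi rfl
      have hzS : z ∈ S := (Finset.mem_insert.1 hz).resolve_left hzx
      change g z ≠ g x at hi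
      change u (g z) (mn (g z)) < u (g z) x ∧ g (mn (g z)) = g z
      have e : mn (g z) = z := hu (g z) (le_antisymm (hmin _ z hzS)
        (hg z _ (Finset.mem_insert_of_mem (hmem _))))
      rw [e]
      exact ⟨lt_of_le_of_ne (hg z x (Finset.mem_insert_self _ _)) (fun h => hzx (hu _ h)), rfl⟩
    have hMx : IsMx u mn (g x) x := by
      refine ⟨fun i hi => (key i hi).1, fun y hy => ?_⟩
      by_cases h : g y = g x
      · rw [← h]; exact hg y x (Finset.mem_insert_self _ _)
      · exact absurd (hg y _ (Finset.mem_insert_of_mem (hmem (g y)))) (not_le.2 (hy _ h))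
    by_cases ha : a = g x
    · left; rw [ha]; exact hMx
    · by_cases hb : b = g x
      · right; rw [hb]; exact hMx
      · exact absurd (by rw [← (key a ha).2, hm, (key b hb).2]) hab
  · rintro (h | h)
    · exact door_aux hD hu hmem hmin hab hm h
    · exact door_aux hD hu hmem hmin hab.symm hm.symm h

theorem exists_mn {V I L : Type*} [LinearOrder L] (u : I → V → L) {S : Finset V}
    (hS : S.Nonempty) : ∃ mn : I → V, (∀ i, mn i ∈ S) ∧ ∀ i, ∀ x ∈ S, u i (mn i) ≤ u i x := by
  have : ∀ i, ∃ z ∈ S, ∀ x ∈ S, u i z ≤ u i x := fun i => Finset.exists_min_image S (u i) hS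
  choose mn h1 h2 using this
  exact ⟨mn, h1, h2⟩

open Classical in
/-- An interior door lies in exactly two rooms. -/
theorem interior_door {V I L : Type*} [Fintype V] [Fintype I] [LinearOrder L]
    {u : I → V → L} (hu : ∀ i, Function.Injective (u i)) (s : I → V)
    (h2 : ∀ i j, i ≠ j → ∀ t, (∀ k, t ≠ s k) → u i t < u i (s j))
    {S : Finset V} (hD : Dom u S) (hcard : S.card + 1 = Fintype.card I)
    {t : V} (htS : t ∈ S) (ht : ∀ k, t ≠ s k) :
    (Finset.univ.filter fun x => x ∉ S ∧ Dom u (insert x S)).card = 2 := by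
  obtain ⟨mn, hmem, hmin⟩ := exists_mn u ⟨t, htS⟩
  obtain ⟨a, -, b, -, hab, hm⟩ := Finset.exists_ne_map_eq_of_card_lt_of_maps_to
    (s := (Finset.univ : Finset I)) (t := S) (f := mn) (by rw [Finset.card_univ]; omega)
    (fun i _ => hmem i)
  have hM : ∀ k, ∃ x, IsMx u mn k x := fun k => exists_isMx u mn k (s k)
    fun i hi => (hmin i t htS).trans_lt (h2 i k hi t ht)
  obtain ⟨xa, hxa⟩ := hM a
  obtain ⟨xb, hxb⟩ := hM b
  rw [Finset.card_eq_two]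
  refine ⟨xa, xb, ?_, ?_⟩
  · rintro rfl
    obtain ⟨i, hi⟩ := hD xa
    have := hi _ (hmem i)
    by_cases h : i = a
    · subst h; exact absurd this (not_le.2 (hxb.1 i hab))
    · exact absurd this (not_le.2 (hxa.1 i h))
  · ext x
    simp only [Finset.mem_filter, Finset.mem_univ, true_and, Finset.mem_insert,
      Finset.mem_singleton]
    rw [door_iff hD hu hcard hmem hmin hab hm]
    constructor
    · rintro (h | h)
      · exact Or.inl (h.unique hu hxa)
      · exact Or.inr (h.unique hu hxb)
    · rintro (rfl | rfl)
      · exact Or.inl hxa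
      · exact Or.inr hxb

open Classical in
/-- The outside door lies in exactly one room. -/
theorem boundary_door {V I L : Type*} [Fintype V] [Fintype I] [LinearOrder L]
    {u : I → V → L} (hu : ∀ i, Function.Injective (u i)) (s : I → V)
    (hs : Function.Injective s)
    (h1 : ∀ i v, v ≠ s i → u i (s i) < u i v)
    (h2 : ∀ i j, i ≠ j → ∀ t, (∀ k, t ≠ s k) → u i t < u i (s j))
    {S : Finset V} (hD : Dom u S) (hcard : S.card + 1 = Fintype.card I)
    (hI : 2 ≤ Fintype.card I) (i₀ : I) (hS : ∀ v, v ∈ S ↔ ∃ i, i ≠ i₀ ∧ v = s i) :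
    (Finset.univ.filter fun x => x ∉ S ∧ Dom u (insert x S)).card = 1 := by
  have hne : S.Nonempty := by rw [← Finset.card_pos]; omega
  obtain ⟨mn, hmem, hmin⟩ := exists_mn u hne
  have hmn : ∀ i, i ≠ i₀ → mn i = s i := by
    intro i hi
    by_contra h
    exact absurd (hmin i (s i) ((hS _).2 ⟨i, hi, rfl⟩)) (not_le.2 (h1 i _ h))
  obtain ⟨j, hj, hmj⟩ := (hS _).1 (hmem i₀)
  have hm : mn i₀ = mn j := by rw [hmj, hmn j hj]
  obtain ⟨x₀, hx₀⟩ := exists_isMx u mn i₀ (s i₀) fun i hi => by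
    rw [hmn i hi]; exact h1 i _ fun h => hi (hs h).symm
  rw [Finset.card_eq_one]
  refine ⟨x₀, ?_⟩
  ext x
  simp only [Finset.mem_filter, Finset.mem_univ, true_and, Finset.mem_singleton]
  rw [door_iff hD hu hcard hmem hmin hj.symm hm]
  constructor
  · rintro (h | h)
    · exact h.unique hu hx₀
    · exfalso
      have h3 := h.1 i₀ hj.symm
      rw [hmj] at h3
      by_cases hx : ∃ k, x = s k
      · obtain ⟨k, rfl⟩ := hx
        by_cases hk : k = i₀
        · subst hk
          exact absurd (h1 k (s j) fun h => hj (hs h)) (not_lt.2 h3.le)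
        · by_cases hkj : k = j
          · subst hkj; exact lt_irrefl _ h3
          · have h4 := h.1 k hkj
            rw [hmn k hk] at h4
            exact lt_irrefl _ h4
      · push Not at hx
        exact absurd (h2 i₀ j hj.symm x hx) (not_lt.2 h3.le)
  · rintro rfl
    exact Or.inl hx₀

open Classical in
/-- A room that is not colorful has an even number of good doors. -/
theorem room_even {V I : Type*} [Fintype V] [Fintype I] (c : V → I) (i₀ : I)
    (R : Finset V) (hR : R.card = Fintype.card I) (hc : R.image c ≠ Finset.univ) :
    Even (Finset.univ.filter fun x =>
      x ∈ R ∧ (R.erase x).image c = Finset.univ.erase i₀).card := by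
  rcases Finset.eq_empty_or_nonempty (Finset.univ.filter fun x =>
      x ∈ R ∧ (R.erase x).image c = Finset.univ.erase i₀) with h | ⟨x₀, hx₀⟩
  · rw [h]; simp
  · simp only [Finset.mem_filter, Finset.mem_univ, true_and] at hx₀
    obtain ⟨hx₀R, hx₀⟩ := hx₀
    have hinj : Set.InjOn c (R.erase x₀ : Finset V) := by
      rw [← Finset.card_image_iff, hx₀, Finset.card_erase_of_mem (Finset.mem_univ _),
        Finset.card_erase_of_mem hx₀R, hR, Finset.card_univ]
    have hci : c x₀ ≠ i₀ := by
      intro h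
      apply hc
      rw [← Finset.insert_erase hx₀R, Finset.image_insert, hx₀, h,
        Finset.insert_erase (Finset.mem_univ _)]
    have : c x₀ ∈ (R.erase x₀).image c := by rw [hx₀]; simp [hci]
    obtain ⟨x₁, hx₁, hcx⟩ := Finset.mem_image.1 this
    have hx₁' := Finset.mem_erase.1 hx₁
    have : (Finset.univ.filter fun x =>
      x ∈ R ∧ (R.erase x).image c = Finset.univ.erase i₀) = {x₀, x₁} := by
      ext x
      simp only [Finset.mem_filter, Finset.mem_univ, true_and, Finset.mem_insert,
        Finset.mem_singleton]
      constructor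
      · rintro ⟨hxR, hx⟩
        by_contra! hne
        have hxe : x ∈ R.erase x₀ := Finset.mem_erase.2 ⟨hne.1, hxR⟩
        have h3 : c x ∈ (R.erase x).image c := by
          rw [hx, ← hx₀]; exact Finset.mem_image_of_mem c hxe
        obtain ⟨z, hz, hzc⟩ := Finset.mem_image.1 h3
        obtain ⟨hzx, hzR⟩ := Finset.mem_erase.1 hz
        by_cases hz0 : z = x₀
        · subst hz0
          exact hne.2 (hinj hxe hx₁ (by rw [← hzc, hcx]))
        · exact hzx (hinj (Finset.mem_coe.2 (Finset.mem_erase.2 ⟨hz0, hzR⟩)) hxe hzc)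
      · rintro (rfl | rfl)
        · exact ⟨hx₀R, hx₀⟩
        · refine ⟨hx₁'.2, ?_⟩
          rw [← hx₀]
          ext k
          simp only [Finset.mem_image, Finset.mem_erase]
          constructor
          · rintro ⟨z, ⟨hz1, hz2⟩, rfl⟩
            by_cases hz : z = x₀
            · exact ⟨x, hx₁', by rw [hz, hcx]⟩
            · exact ⟨z, ⟨hz, hz2⟩, rfl⟩
          · rintro ⟨z, ⟨hz1, hz2⟩, rfl⟩
            by_cases hz : z = x
            · exact ⟨x₀, ⟨hx₁'.1.symm, hx₀R⟩, by rw [hz, hcx]⟩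
            · exact ⟨z, ⟨hz, hz2⟩, rfl⟩
    rw [this, Finset.card_pair hx₁'.1.symm]
    exact even_two

open Classical in
/-- Scarf's combinatorial lemma. -/
theorem scarf {V I L : Type*} [Fintype V] [Fintype I] [LinearOrder L]
    {u : I → V → L} (hu : ∀ i, Function.Injective (u i)) (s : I → V)
    (h1 : ∀ i v, v ≠ s i → u i (s i) < u i v)
    (h2 : ∀ i j, i ≠ j → ∀ t, (∀ k, t ≠ s k) → u i t < u i (s j))
    (hI : 2 ≤ Fintype.card I) (c : V → I) (hc : ∀ i, c (s i) = i) :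
    ∃ R : Finset V, Dom u R ∧ R.image c = Finset.univ := by
  by_contra! hcon
  have hs : Function.Injective s := fun i j h => by rw [← hc i, h, hc]
  obtain ⟨i₀⟩ : Nonempty I := Fintype.card_pos_iff.1 (by omega)
  let D : Finset (Finset V) := Finset.univ.filter fun S =>
    Dom u S ∧ S.card + 1 = Fintype.card I ∧ S.image c = Finset.univ.erase i₀
  let Rm : Finset (Finset V) := Finset.univ.filter fun R => Dom u R ∧ R.card = Fintype.card I
  have hcount : ∑ S ∈ D, (Finset.univ.filter fun x => x ∉ S ∧ Dom u (insert x S)).card =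
      ∑ R ∈ Rm, (Finset.univ.filter fun x =>
        x ∈ R ∧ (R.erase x).image c = Finset.univ.erase i₀).card := by
    rw [← Finset.card_sigma, ← Finset.card_sigma]
    refine Finset.card_nbij' (fun p => ⟨insert p.2 p.1, p.2⟩) (fun p => ⟨p.1.erase p.2, p.2⟩)
      ?_ ?_ ?_ ?_
    · rintro ⟨S, x⟩ h
      simp only [D, Rm, Finset.coe_sigma, Set.mem_sigma_iff, Finset.mem_coe,
        Finset.mem_filter, Finset.mem_univ, true_and] at h ⊢
      obtain ⟨⟨a1, a2, a3⟩, a4, a5⟩ := h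
      refine ⟨⟨a5, by rw [Finset.card_insert_of_notMem a4, a2]⟩, Finset.mem_insert_self _ _, ?_⟩
      rw [Finset.erase_insert a4, a3]
    · rintro ⟨R, x⟩ h
      simp only [D, Rm, Finset.coe_sigma, Set.mem_sigma_iff, Finset.mem_coe,
        Finset.mem_filter, Finset.mem_univ, true_and] at h ⊢
      obtain ⟨⟨a1, a2⟩, a4, a5⟩ := h
      refine ⟨⟨?_, by rw [Finset.card_erase_add_one a4, a2], a5⟩, by simp, ?_⟩
      · intro y
        obtain ⟨i, hi⟩ := a1 y
        exact ⟨i, fun z hz => hi z (Finset.mem_of_mem_erase hz)⟩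
      · rw [Finset.insert_erase a4]; exact a1
    · rintro ⟨S, x⟩ h
      simp only [D, Rm, Finset.coe_sigma, Set.mem_sigma_iff, Finset.mem_coe,
        Finset.mem_filter, Finset.mem_univ, true_and] at h ⊢
      rw [Finset.erase_insert h.2.1]
    · rintro ⟨R, x⟩ h
      simp only [D, Rm, Finset.coe_sigma, Set.mem_sigma_iff, Finset.mem_coe,
        Finset.mem_filter, Finset.mem_univ, true_and] at h ⊢
      rw [Finset.insert_erase h.2.1]
  have hev : Even (∑ R ∈ Rm, (Finset.univ.filter fun x =>
        x ∈ R ∧ (R.erase x).image c = Finset.univ.erase i₀).card) := by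
    apply Finset.even_sum
    intro R hR
    simp only [Rm, Finset.mem_filter, Finset.mem_univ, true_and] at hR
    exact room_even c i₀ R hR.2 (hcon R hR.1)
  let S₀ : Finset V := (Finset.univ.erase i₀).image s
  have hS₀mem : ∀ v, v ∈ S₀ ↔ ∃ i, i ≠ i₀ ∧ v = s i := by
    intro v
    simp only [S₀, Finset.mem_image, Finset.mem_erase, Finset.mem_univ, and_true]
    exact ⟨fun ⟨i, a, b⟩ => ⟨i, a, b.symm⟩, fun ⟨i, a, b⟩ => ⟨i, a, b.symm⟩⟩
  have hS₀D : S₀ ∈ D := by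
    simp only [D, Finset.mem_filter, Finset.mem_univ, true_and]
    refine ⟨?_, ?_, ?_⟩
    · intro y
      by_cases hy : ∃ j, y = s j
      · obtain ⟨j, rfl⟩ := hy
        refine ⟨j, fun x _ => ?_⟩
        by_cases hx : x = s j
        · rw [hx]
        · exact (h1 j x hx).le
      · push Not at hy
        refine ⟨i₀, fun x hx => ?_⟩
        obtain ⟨i, hi, rfl⟩ := (hS₀mem x).1 hx
        exact (h2 i₀ i hi.symm y hy).le
    · rw [Finset.card_image_of_injective _ hs, Finset.card_erase_add_one (Finset.mem_univ _),
        Finset.card_univ]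
    · ext k
      simp [S₀, Finset.mem_image, hc]
  rw [← hcount, ← Finset.add_sum_erase _ _ hS₀D] at hev
  have hS₀' := hS₀D
  simp only [D, Finset.mem_filter, Finset.mem_univ, true_and] at hS₀'
  rw [boundary_door hu s hs h1 h2 hS₀'.1 hS₀'.2.1 hI i₀ hS₀mem] at hev
  have hev2 : Even (∑ S ∈ D.erase S₀,
      (Finset.univ.filter fun x => x ∉ S ∧ Dom u (insert x S)).card) := by
    apply Finset.even_sum
    intro S hS
    obtain ⟨hne, hS⟩ := Finset.mem_erase.1 hS
    simp only [D, Finset.mem_filter, Finset.mem_univ, true_and] at hS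
    have : ∃ t ∈ S, ∀ k, t ≠ s k := by
      by_contra! h
      apply hne
      apply Finset.eq_of_subset_of_card_le
      · intro v hv
        obtain ⟨k, rfl⟩ := h v hv
        refine (hS₀mem _).2 ⟨k, ?_, rfl⟩
        have : c (s k) ∈ S.image c := Finset.mem_image_of_mem c hv
        rw [hS.2.2, hc] at this
        exact (Finset.mem_erase.1 this).1
      · have := hS.2.1
        have := hS₀'.2.1
        omega
    obtain ⟨t, htS, ht⟩ := this
    rw [interior_door hu s h2 hS.1 hS.2.1 htS ht]
    exact even_two
  rw [Nat.even_add] at hev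
  exact Nat.not_even_one (hev.2 hev2)

/-- Lattice points of the `n`-th dilate of the simplex. -/
abbrev Grid (m n : ℕ) := {x : Fin m → ℕ // x ∈ Finset.piAntidiag (Finset.univ) n}

theorem Grid.sum_eq {m n : ℕ} (x : Grid m n) : ∑ i, x.1 i = n :=
  (Finset.mem_piAntidiag.1 x.2).1

/-- weights -/
def w (m n : ℕ) : Grid m n ⊕ Fin m → Fin m → ℤ
  | Sum.inl x, i => (x.1 i : ℤ)
  | Sum.inr j, i => if i = j then -1 else (n : ℤ) + 1

theorem grid_le {m n : ℕ} (x : Grid m n) (i : Fin m) : x.1 i ≤ n := by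
  conv_rhs => rw [← x.sum_eq]
  exact Finset.single_le_sum (f := x.1) (fun _ _ => Nat.zero_le _) (Finset.mem_univ i)

theorem grid_lemma {m : ℕ} (hm : 2 ≤ m) (n : ℕ) (c : Grid m n → Fin m) :
    ∃ p : Grid m n, ∀ i, p.1 i ≤ m ∨
      ∃ q : Grid m n, c q = i ∧ ∀ k, |(q.1 k : ℤ) - p.1 k| ≤ m := by
  classical
  let e := Fintype.equivFin (Grid m n ⊕ Fin m)
  let u : Fin m → Grid m n ⊕ Fin m → ℤ ×ₗ ℕ := fun i v => toLex (w m n v i, (e v : ℕ))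
  have hlt : ∀ i v v', w m n v i < w m n v' i → u i v < u i v' := fun i v v' h =>
    Prod.Lex.toLex_lt_toLex.2 (Or.inl h)
  have hle : ∀ i v v', u i v ≤ u i v' → w m n v i ≤ w m n v' i := fun i v v' h =>
    not_lt.1 fun h' => absurd h (not_le.2 (hlt i v' v h'))
  have hu : ∀ i, Function.Injective (u i) := by
    intro i v v' h
    have h' : (w m n v i, (e v : ℕ)) = (w m n v' i, (e v' : ℕ)) := toLex.injective h
    exact e.injective (Fin.ext (Prod.ext_iff.1 h').2)
  obtain ⟨S, hD, hS⟩ := scarf hu Sum.inr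
    (by
      rintro i (x | j) hv
      · apply hlt; simp only [w, if_true]; omega
      · apply hlt
        have : i ≠ j := fun h => hv (by rw [h])
        simp only [w, if_true, if_neg this]; omega)
    (by
      rintro i j hij (x | k) ht
      · apply hlt
        have := grid_le x i
        simp only [w, if_neg hij]; omega
      · exact absurd rfl (ht k))
    (by simpa using hm) (Sum.elim c id) (fun i => rfl)
  have hcol : ∀ i, ∃ v ∈ S, Sum.elim c id v = i := by
    intro i
    have := Finset.mem_univ i
    rw [← hS] at this
    simpa only [Finset.mem_image] using this
  let i₁ : Fin m := ⟨0, by omega⟩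
  have hp : ∃ p : Grid m n, Sum.inl p ∈ S := by
    by_contra! h
    have hall : ∀ i : Fin m, Sum.inr i ∈ S := by
      intro i
      obtain ⟨v | j, hv, hvi⟩ := hcol i
      · exact absurd hv (h v)
      · simp at hvi; rwa [← hvi]
    obtain ⟨i, hi⟩ := hD (Sum.inl ⟨Pi.single i₁ n, by simp [Finset.mem_piAntidiag]⟩)
    have := hle _ _ _ (hi _ (hall i))
    simp only [w, if_true] at this
    omega
  obtain ⟨p, hpS⟩ := hp
  have hl : ∀ i, ∃ x : Grid m n, Sum.inl x ∈ S ∧ ∀ y : Grid m n, Sum.inl y ∈ S →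
      x.1 i ≤ y.1 i := by
    intro i
    obtain ⟨x, hx, hmin⟩ := Finset.exists_min_image
      (Finset.univ.filter fun x : Grid m n => Sum.inl x ∈ S) (fun x => x.1 i) ⟨p, by simpa⟩
    exact ⟨x, by simpa using hx, fun y hy => hmin y (by simpa using hy)⟩
  choose lx hlS hlmin using hl
  let l : Fin m → ℕ := fun i => if Sum.inr i ∈ S then 0 else (lx i).1 i
  let l1 : Fin m → ℕ := fun i => if Sum.inr i ∈ S then 0 else (lx i).1 i + 1
  have hll : ∑ i, l1 i ≤ ∑ i, l i + m := by
    calc ∑ i, l1 i ≤ ∑ i, (l i + 1) := by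
          apply Finset.sum_le_sum
          intro i _
          simp only [l, l1]
          split_ifs <;> omega
      _ = _ := by simp [Finset.sum_add_distrib]
  have hkey : n < ∑ i, l1 i := by
    by_contra! h
    obtain ⟨i, hi⟩ := hD (Sum.inl ⟨l1 + Pi.single i₁ (n - ∑ i, l1 i), by
      simp [Finset.mem_piAntidiag, Finset.sum_add_distrib]; omega⟩)
    by_cases hiS : Sum.inr i ∈ S
    · have := hle _ _ _ (hi _ hiS)
      simp only [w, if_true] at this
      omega
    · have := hle _ _ _ (hi _ (hlS i))
      simp only [w, Pi.add_apply, l1, if_neg hiS] at this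
      omega
  have hlow : ∀ x : Grid m n, Sum.inl x ∈ S → ∀ k, l k ≤ x.1 k := by
    intro x hx k
    simp only [l]
    split_ifs
    · omega
    · exact hlmin k x hx
  have hup : ∀ x : Grid m n, Sum.inl x ∈ S → ∀ k, x.1 k ≤ l k + m := by
    intro x hx k
    have e1 : ∑ i, (x.1 i - l i) + ∑ i, l i = n := by
      rw [← Finset.sum_add_distrib]
      refine Eq.trans ?_ x.sum_eq
      exact Finset.sum_congr rfl fun i _ => Nat.sub_add_cancel (hlow x hx i)
    have e2 : x.1 k - l k ≤ ∑ i, (x.1 i - l i) :=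
      Finset.single_le_sum (f := fun i => x.1 i - l i) (fun _ _ => Nat.zero_le _)
        (Finset.mem_univ k)
    omega
  refine ⟨p, fun i => ?_⟩
  obtain ⟨q | j, hv, hvi⟩ := hcol i
  · right
    refine ⟨q, hvi, fun k => ?_⟩
    have a1 := hlow q hv k
    have a2 := hlow p hpS k
    have a3 := hup q hv k
    have a4 := hup p hpS k
    rw [abs_le]
    omega
  · left
    simp at hvi
    subst hvi
    have := hup p hpS j
    simpa only [l, if_pos hv, zero_add] using this

/-- normalized grid point -/
noncomputable def pt {m n : ℕ} (x : Grid m (n + 1)) : stdSimplex ℝ (Fin m) :=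
  ⟨fun i => (x.1 i : ℝ) / (n + 1), fun i => by positivity, by
    rw [← Finset.sum_div, ← Nat.cast_sum, x.sum_eq]
    push_cast
    exact div_self (by positivity)⟩

end Scarf

open Filter Topology in
/-- A continuous self-map of the standard simplex `Δ_m ⊆ ℝ^m` which maps every face
`Δ_J = {x ∈ Δ_m : x_i = 0 for i ∉ J}` into itself is surjective. -/
theorem stmt18 {m : ℕ} (μ : stdSimplex ℝ (Fin m) → stdSimplex ℝ (Fin m))
    (hcont : Continuous μ)
    (hface : ∀ (J : Set (Fin m)) (x : stdSimplex ℝ (Fin m)),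
      (∀ i ∉ J, (x : Fin m → ℝ) i = 0) → ∀ i ∉ J, (μ x : Fin m → ℝ) i = 0) :
    Function.Surjective μ := by
  intro y
  have heq : ∀ z : stdSimplex ℝ (Fin m), (∀ i, z.1 i ≤ y.1 i) → z = y := by
    intro z hz
    apply Subtype.ext
    funext i
    exact (Finset.sum_eq_sum_iff_of_le (fun i _ => hz i)).1 (z.2.2.trans y.2.2.symm) i
      (Finset.mem_univ i)
  have hzero : ∀ (x : stdSimplex ℝ (Fin m)) i, x.1 i = 0 → (μ x).1 i = 0 := by
    intro x i hi
    exact hface {i}ᶜ x (fun j hj => by simp at hj; rw [hj]; exact hi) i (by simp)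
  by_cases hm : 2 ≤ m
  · have hlab : ∀ x : stdSimplex ℝ (Fin m), ∃ i, (μ x).1 i ≤ y.1 i := by
      intro x
      obtain ⟨i, -, hi⟩ := Finset.exists_le_of_sum_le
        (s := (Finset.univ : Finset (Fin m))) (f := (μ x).1) (g := y.1)
        ⟨⟨0, by omega⟩, Finset.mem_univ _⟩ ((μ x).2.2.trans y.2.2.symm).le
      exact ⟨i, hi⟩
    choose lab hlab using hlab
    have hgrid := fun n : ℕ => Scarf.grid_lemma hm (n + 1) (fun x => lab (Scarf.pt x))
    choose p hp using hgrid
    obtain ⟨x, -, φ, hφ, hx⟩ := (isCompact_univ (X := stdSimplex ℝ (Fin m))).tendsto_subseq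
      (x := fun n => Scarf.pt (p n)) (fun _ => Set.mem_univ _)
    refine ⟨x, heq _ fun i => ?_⟩
    by_contra! hlt
    have hxi : 0 < x.1 i := by
      rcases (x.2.1 i).lt_or_eq with h | h
      · exact h
      · rw [hzero x i h.symm] at hlt
        exact absurd hlt (not_lt.2 (y.2.1 i))
    have hU : ∀ᶠ z in 𝓝 x, y.1 i < (μ z).1 i :=
      ((continuous_apply i).comp (continuous_subtype_val.comp hcont)).continuousAt.eventually
        (lt_mem_nhds hlt)
    obtain ⟨ε, hε, hball⟩ := Metric.eventually_nhds_iff.1 hU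
    have hsm : Tendsto (fun n : ℕ => (m : ℝ) / ((n : ℝ) + 1)) atTop (𝓝 0) := by
      simpa [div_eq_mul_inv] using (tendsto_one_div_add_atTop_nhds_zero_nat (𝕜 := ℝ)).const_mul (m : ℝ)
    have hsm' := hsm.comp hφ.tendsto_atTop
    have hci : Tendsto (fun n => (Scarf.pt (p (φ n))).1 i) atTop (𝓝 (x.1 i)) :=
      (((continuous_apply i).comp continuous_subtype_val).tendsto x).comp hx
    have E1 := hsm'.eventually (gt_mem_nhds (half_pos hxi))
    have E2 := hci.eventually (lt_mem_nhds (half_lt_self hxi))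
    have E3 := hsm'.eventually (gt_mem_nhds (half_pos hε))
    have E4 := (tendsto_iff_dist_tendsto_zero.1 hx).eventually (gt_mem_nhds (half_pos hε))
    obtain ⟨n, e1, e2, e3, e4⟩ := (E1.and (E2.and (E3.and E4))).exists
    simp only [Function.comp] at e1 e2 e3 e4
    have hpos : (0 : ℝ) < (φ n : ℝ) + 1 := by positivity
    rcases hp (φ n) i with h | ⟨q, hq, hd⟩
    · have : (Scarf.pt (p (φ n))).1 i ≤ (m : ℝ) / ((φ n : ℝ) + 1) := by
        change ((p (φ n)).1 i : ℝ) / ((φ n : ℝ) + 1) ≤ _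
        gcongr
      linarith
    · have hdist : dist (Scarf.pt q) (Scarf.pt (p (φ n))) ≤ (m : ℝ) / ((φ n : ℝ) + 1) := by
        rw [Subtype.dist_eq, dist_pi_le_iff (by positivity)]
        intro k
        change dist ((q.1 k : ℝ) / ((φ n : ℝ) + 1)) (((p (φ n)).1 k : ℝ) / ((φ n : ℝ) + 1)) ≤ _
        rw [Real.dist_eq, ← sub_div, abs_div, abs_of_pos hpos]
        gcongr
        exact_mod_cast hd k
      have h3 := hball (y := Scarf.pt q) (by
        have := dist_triangle (Scarf.pt q) (Scarf.pt (p (φ n))) x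
        linarith)
      have h4 := hlab (Scarf.pt q)
      rw [hq] at h4
      linarith
  · refine ⟨y, ?_⟩
    apply Subtype.ext
    have : Subsingleton (Fin m) := Fin.subsingleton_iff_le_one.2 (by omega)
    funext i
    have h1 : ∀ z : stdSimplex ℝ (Fin m), z.1 i = 1 := by
      intro z
      have := z.2.2
      rwa [Fintype.sum_subsingleton _ i] at this
    rw [h1, h1]
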